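/- arXiv:2103.04215 — 2 statements merged into one kernel-verified Lean document; each statement's English description precedes it below -/
import Mathlib

section
/- Fix α ∈ (0,1) and p, q ∈ (0,1)^N with p_1 ≤ p_2 ≤ … ≤ p_N ≤ 1/2 and m(p) > 2, and let M = ⌈m(p)⌉ and k = ⌈m(p)⌉ − ⌊m(p)/2⌋. Let i ∈ {1,…,M} be an index such that there are at least k indices ℓ ∈ {1,…,M} \ {i} with q_ℓ ≥ q_i. Then α · p_i · ∏_{ℓ ∈ {1,…,M} \ {i}} (1 − p_ℓ) + (1 − α) · q_i · ∏_{ℓ ∈ {1,…,M} \ {i}} (1 − q_ℓ) ≤ 1/m(p). (This quantity is the probability, in the Bernoulli HCB, that under the empty intervention do(∅) the arm vector X lies in the set 𝒳_i* = { x ∈ {0,1}^N : x_i = 1 and x_ℓ = 0 for all ℓ ∈ {1,…,M} \ {i} }.) -/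
open Finset

/-- For `v : Fin N → ℝ` and `s : ℝ`, the index set
`I_s(v) = { n : min (v n) (1 - v n) < 1/s }`. -/
noncomputable def Ival {N : ℕ} (v : Fin N → ℝ) (s : ℝ) : Finset (Fin N) :=
  Finset.univ.filter (fun n => min (v n) (1 - v n) < 1 / s)

/-- `m(v) = min { s > 0 : s ≥ |I_s(v)| }` (the minimum exists; we use `sInf`). -/
noncomputable def mVal {N : ℕ} (v : Fin N → ℝ) : ℝ :=
  sInf {s : ℝ | 0 < s ∧ ((Ival v s).card : ℝ) ≤ s}

/-- Second-order Bernoulli inequality. -/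
theorem one_add_mul_add_sq_le_pow {x : ℝ} (hx : 0 ≤ x) (k : ℕ) :
    1 + k * x + k * (k - 1) / 2 * x ^ 2 ≤ (1 + x) ^ k := by
  induction k with
  | zero => simp
  | succ k ih =>
    have hk : (0 : ℝ) ≤ k * (k - 1) := by
      rcases Nat.eq_zero_or_pos k with rfl | h
      · simp
      · have : (1 : ℝ) ≤ k := by exact_mod_cast h
        exact mul_nonneg (by linarith) (by linarith)
    have h3 : 0 ≤ (k * (k - 1) : ℝ) * x ^ 3 := by positivity
    rw [pow_succ]
    push_cast
    refine le_trans ?_ (mul_le_mul_of_nonneg_right ih (by linarith : 0 ≤ 1 + x))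
    linear_combination h3 / 2

theorem two_mul_mul_le_one_add_pow {x : ℝ} (hx : 0 ≤ x) (hx1 : x ≤ 1) (k : ℕ) :
    2 * k * x ≤ (1 + x) ^ k := by
  rcases k with _ | _ | k
  · simp
  · simp
    linarith
  · refine le_trans ?_ (one_add_mul_add_sq_le_pow hx _)
    push_cast
    have hk : (0 : ℝ) ≤ k := k.cast_nonneg
    nlinarith [sq_nonneg (((k : ℝ) + 2) * x - 2), sq_nonneg (((k : ℝ) + 1) * x - 1),
      mul_nonneg hk (sq_nonneg x)]

theorem two_mul_mul_mul_one_sub_pow_le_one {x : ℝ} (hx : 0 ≤ x) (hx1 : x ≤ 1) (k : ℕ) :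
    2 * k * (x * (1 - x) ^ k) ≤ 1 :=
  calc 2 * k * (x * (1 - x) ^ k) = 2 * k * x * (1 - x) ^ k := by ring
    _ ≤ (1 + x) ^ k * (1 - x) ^ k :=
      mul_le_mul_of_nonneg_right (two_mul_mul_le_one_add_pow hx hx1 k)
        (pow_nonneg (by linarith) k)
    _ = (1 - x ^ 2) ^ k := by rw [← mul_pow]; ring
    _ ≤ 1 := pow_le_one₀ (by nlinarith) (by nlinarith)

theorem lt_card_Ival_of_lt_mVal {N : ℕ} {v : Fin N → ℝ} {s : ℝ} (hs : 0 < s)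
    (h : s < mVal v) : s < (Ival v s).card := by
  by_contra! hc
  exact notMem_of_lt_csInf h ⟨0, fun _ ht => ht.1.le⟩ ⟨hs, hc⟩

theorem le_one_div_mVal {N : ℕ} {p : Fin N → ℝ} (hmono : Monotone p)
    (hhalf : ∀ j, p j ≤ 1 / 2) (hm : 0 < mVal p) (i : Fin N) (hi : (i : ℝ) < mVal p) :
    p i ≤ 1 / mVal p := by
  by_contra! hlt
  have hpi : 0 < p i := (one_div_pos.2 hm).trans hlt
  set s := max (1 / p i) (i : ℝ) with hs
  have hs0 : 0 < s := lt_max_of_lt_left (one_div_pos.2 hpi)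
  have hsm : s < mVal p := max_lt ((one_div_lt hm hpi).1 hlt) hi
  have hsub : Ival p s ⊆ Iio i := by
    intro n hn
    rw [Ival, mem_filter, min_eq_left (by linarith [hhalf n])] at hn
    have hsp : 1 / s ≤ p i := (one_div_le hs0 hpi).2 (le_max_left _ _)
    exact mem_Iio.2 (hmono.reflect_lt (hn.2.trans_le hsp))
  have hcard : ((Ival p s).card : ℝ) ≤ i := by
    exact_mod_cast (card_le_card hsub).trans_eq (Fin.card_Iio i)
  linarith [lt_card_Ival_of_lt_mVal hs0 hsm, le_max_right (1 / p i) (i : ℝ)]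

theorem prod_one_sub_le_pow {ι : Type*} {S T : Finset ι} {q : ι → ℝ} {x : ℝ} {k : ℕ}
    (hq0 : ∀ j, 0 ≤ q j) (hq1 : ∀ j, q j ≤ 1) (hx0 : 0 ≤ x) (hx1 : x ≤ 1) (hST : S ⊆ T)
    (hS : ∀ j ∈ S, x ≤ q j) (hk : k ≤ S.card) :
    ∏ j ∈ T, (1 - q j) ≤ (1 - x) ^ k :=
  calc ∏ j ∈ T, (1 - q j) ≤ ∏ j ∈ S, (1 - q j) :=
        prod_le_prod_of_subset_of_le_one hST (fun j _ => by linarith [hq1 j])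
          (fun j _ _ => by linarith [hq0 j])
    _ ≤ ∏ _j ∈ S, (1 - x) :=
        prod_le_prod (fun j _ => by linarith [hq1 j]) (fun j hj => by linarith [hS j hj])
    _ = (1 - x) ^ S.card := prod_const _
    _ ≤ (1 - x) ^ k := pow_le_pow_of_le_one (by linarith) (by linarith) hk

/-- for sorted `p` with `p_N ≤ 1/2` and `m(p) > 2`, with
`M = ⌈m(p)⌉`, `k = ⌈m(p)⌉ - ⌊m(p)/2⌋`, and an index `i` among the first `M`
indices such that at least `k` indices `ℓ < M`, `ℓ ≠ i` satisfy `q_ℓ ≥ q_i`,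
one has
`α p_i ∏_{ℓ < M, ℓ ≠ i} (1 - p_ℓ) + (1-α) q_i ∏_{ℓ < M, ℓ ≠ i} (1 - q_ℓ) ≤ 1/m(p)`.
(Indices are 0-based: `ℓ ∈ {1,…,M}` becomes `(ℓ : ℕ) < M`.) -/
theorem stmt12 {N : ℕ} (α : ℝ) (hα : α ∈ Set.Ioo (0 : ℝ) 1)
    (p q : Fin N → ℝ) (hp : ∀ j, p j ∈ Set.Ioo (0 : ℝ) 1)
    (hq : ∀ j, q j ∈ Set.Ioo (0 : ℝ) 1)
    (hmono : Monotone p) (hhalf : ∀ j, p j ≤ 1 / 2) (hm : 2 < mVal p)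
    (M : ℕ) (hM : (M : ℤ) = ⌈mVal p⌉)
    (k : ℕ) (hk : (k : ℤ) = ⌈mVal p⌉ - ⌊mVal p / 2⌋)
    (i : Fin N) (hi : (i : ℕ) < M)
    (hcard : k ≤ (univ.filter
      (fun ℓ : Fin N => (ℓ : ℕ) < M ∧ ℓ ≠ i ∧ q i ≤ q ℓ)).card) :
    α * p i * ∏ ℓ ∈ univ.filter (fun ℓ : Fin N => (ℓ : ℕ) < M ∧ ℓ ≠ i), (1 - p ℓ) +
      (1 - α) * q i *
        ∏ ℓ ∈ univ.filter (fun ℓ : Fin N => (ℓ : ℕ) < M ∧ ℓ ≠ i), (1 - q ℓ) ≤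
      1 / mVal p := by
  have hm0 : 0 < mVal p := by linarith
  have him : (i : ℝ) < mVal p := by
    have h : ((i : ℕ) : ℤ) < ⌈mVal p⌉ := by rw [← hM]; exact_mod_cast hi
    exact_mod_cast Int.lt_ceil.1 h
  have hpi := le_one_div_mVal hmono hhalf hm0 i him
  have hkm : mVal p ≤ 2 * k := by
    have h : (k : ℝ) = ⌈mVal p⌉ - ⌊mVal p / 2⌋ := by exact_mod_cast hk
    linarith [Int.le_ceil (mVal p), Int.floor_le (mVal p / 2)]
  have hprodp : ∏ ℓ ∈ univ.filter (fun ℓ : Fin N => (ℓ : ℕ) < M ∧ ℓ ≠ i), (1 - p ℓ) ≤ 1 :=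
    prod_le_one (fun j _ => by linarith [(hp j).2]) (fun j _ => by linarith [(hp j).1])
  have hprodq : ∏ ℓ ∈ univ.filter (fun ℓ : Fin N => (ℓ : ℕ) < M ∧ ℓ ≠ i), (1 - q ℓ) ≤
      (1 - q i) ^ k :=
    prod_one_sub_le_pow (fun j => (hq j).1.le) (fun j => (hq j).2.le) (hq i).1.le (hq i).2.le
      (monotone_filter_right _ fun _ _ h => ⟨h.1, h.2.1⟩)
      (fun j hj => (mem_filter.1 hj).2.2.2) hcard
  have hpterm : p i * ∏ ℓ ∈ univ.filter (fun ℓ : Fin N => (ℓ : ℕ) < M ∧ ℓ ≠ i), (1 - p ℓ) ≤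
      1 / mVal p :=
    (mul_le_of_le_one_right (hp i).1.le hprodp).trans hpi
  have hqterm : q i * ∏ ℓ ∈ univ.filter (fun ℓ : Fin N => (ℓ : ℕ) < M ∧ ℓ ≠ i), (1 - q ℓ) ≤
      1 / mVal p := by
    refine (mul_le_mul_of_nonneg_left hprodq (hq i).1.le).trans ?_
    rw [le_div_iff₀' hm0]
    refine le_trans (mul_le_mul_of_nonneg_right hkm ?_)
      (two_mul_mul_mul_one_sub_pow_le_one (hq i).1.le (hq i).2.le k)
    exact mul_nonneg (hq i).1.le (pow_nonneg (by linarith [(hq i).2]) k)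
  rw [mul_assoc, mul_assoc]
  linarith [mul_le_mul_of_nonneg_left hpterm hα.1.le,
    mul_le_mul_of_nonneg_left hqterm (sub_nonneg.2 hα.2.le)]
end

section
/- Let N ∈ ℕ, T' ∈ ℕ, α ∈ (0,1), and p, p̂ ∈ (0,1)^N, and write m₁ = m(p) and m̂₁ = m(p̂). Suppose that (i) for every i ∈ {1,…,N}, |p̂_i − p_i| ≤ p_i · √( 27 log(2NT') / (α p_i T') ) and |(1 − p̂_i) − (1 − p_i)| ≤ (1 − p_i) · √( 27 log(2NT') / (α (1 − p_i) T') ); and (ii) T' > 108 m₁ log(2NT') / α. Then (2/3) m₁ ≤ m̂₁ ≤ 2 m₁. -/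
theorem mVal_bddBelow {N : ℕ} (v : Fin N → ℝ) :
    BddBelow {s : ℝ | 0 < s ∧ ((Ival v s).card : ℝ) ≤ s} :=
  ⟨0, fun _ hs => hs.1.le⟩

theorem mVal_le {N : ℕ} {v : Fin N → ℝ} {s : ℝ} (hs : 0 < s)
    (h : ((Ival v s).card : ℝ) ≤ s) : mVal v ≤ s :=
  csInf_le (mVal_bddBelow v) ⟨hs, h⟩

theorem mVal_set_nonempty {N : ℕ} (v : Fin N → ℝ) :
    {s : ℝ | 0 < s ∧ ((Ival v s).card : ℝ) ≤ s}.Nonempty := by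
  refine ⟨N + 1, by positivity, ?_⟩
  have h : (Ival v (N + 1)).card ≤ N := by
    simpa using Finset.card_le_univ (Ival v (N + 1))
  have : ((Ival v (N + 1)).card : ℝ) ≤ N := by exact_mod_cast h
  linarith

theorem Ival_anti {N : ℕ} (v : Fin N → ℝ) {s t : ℝ} (hs : 0 < s) (hst : s ≤ t) :
    Ival v t ⊆ Ival v s := by
  intro n hn
  simp only [Ival, Finset.mem_filter, Finset.mem_univ, true_and] at hn ⊢
  exact hn.trans_le (one_div_le_one_div_of_le hs hst)

theorem one_le_mVal {N : ℕ} (hN : 0 < N) (v : Fin N → ℝ) : 1 ≤ mVal v := by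
  refine le_csInf (mVal_set_nonempty v) ?_
  rintro s ⟨hs, hc⟩
  by_contra! hlt
  have hmem : (⟨0, hN⟩ : Fin N) ∈ Ival v s := by
    simp only [Ival, Finset.mem_filter, Finset.mem_univ, true_and]
    have h1 : 1 < 1 / s := by rw [lt_div_iff₀ hs]; linarith
    rcases le_total (v ⟨0, hN⟩) 1 with h | h
    · exact (min_le_left _ _).trans_lt (by linarith)
    · exact (min_le_right _ _).trans_lt (by linarith)
  have h1 : (1 : ℝ) ≤ (Ival v s).card := by exact_mod_cast Finset.card_pos.mpr ⟨_, hmem⟩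
  linarith

/-- The infimum defining `mVal` is attained. -/
theorem card_Ival_mVal_le {N : ℕ} (v : Fin N → ℝ) (hm : 0 < mVal v) :
    ((Ival v (mVal v)).card : ℝ) ≤ mVal v := by
  by_contra! hlt
  have h1 : ∀ᶠ s in nhds (mVal v), ∀ n ∈ Ival v (mVal v), min (v n) (1 - v n) < 1 / s := by
    rw [Filter.eventually_all_finset]
    intro n hn
    have hc : ContinuousAt (fun s : ℝ => 1 / s) (mVal v) :=
      continuousAt_const.div continuousAt_id hm.ne'
    exact hc.eventually_const_lt (by simpa [Ival] using hn)
  have h2 := (h1.and (eventually_lt_nhds hlt)).filter_mono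
    (nhdsWithin_le_nhds (s := Set.Ioi (mVal v)))
  obtain ⟨s, ⟨hs1, hs2⟩, hs3⟩ := (h2.and self_mem_nhdsWithin).exists
  obtain ⟨t, ⟨ht0, htc⟩, hts⟩ := exists_lt_of_csInf_lt (mVal_set_nonempty v) hs3
  have hsub : Ival v (mVal v) ⊆ Ival v t := fun n hn =>
    Ival_anti v ht0 hts.le (by simpa [Ival] using hs1 n hn)
  have hle : ((Ival v (mVal v)).card : ℝ) ≤ (Ival v t).card := by
    exact_mod_cast Finset.card_le_card hsub
  linarith

theorem mul_sqrt_div_le {x a b c : ℝ} (hx : 0 < x) (hxb : x ≤ b) (hcb : c ≤ a / 4)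
    (hab : a ≤ b) (hb : 0 < b) :
    x * √(c / x) ≤ b / 2 := by
  have h : x * √(c / x) = √(c * x) := by
    rw [show c * x = x ^ 2 * (c / x) by field_simp, Real.sqrt_mul (sq_nonneg x),
      Real.sqrt_sq hx.le]
  rw [h]
  apply Real.sqrt_le_iff.mpr
  constructor
  · positivity
  · nlinarith

theorem lt_of_abs_sub_le_mul_sqrt {x y m r c : ℝ} (hx : 0 < x)
    (hc : c ≤ 1 / m / 4) (h : |y - x| ≤ x * √(c / x)) (hxr : x < r) (hmr : 1 / m ≤ r) :
    y < 3 / 2 * r := by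
  have := mul_sqrt_div_le hx hxr.le hc hmr (hx.trans hxr)
  have := (abs_le.mp h).2
  linarith

theorem half_le_of_abs_sub_le_mul_sqrt {x y m c : ℝ} (hm : 0 < m)
    (hc : c ≤ 1 / m / 4) (h : |y - x| ≤ x * √(c / x)) (hmx : 1 / m ≤ x) :
    1 / (2 * m) ≤ y := by
  have hx : 0 < x := lt_of_lt_of_le (by positivity) hmx
  have := mul_sqrt_div_le hx le_rfl hc hmx hx
  have := (abs_le.mp h).1
  have : 1 / (2 * m) = 1 / m / 2 := by field_simp
  linarith

/-- if the estimates `p̂_i` satisfy the stated multiplicative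
accuracy bounds (for both `p_i` and `1 - p_i`) and
`T' > 108 m(p) log(2NT') / α`, then `(2/3) m(p) ≤ m(p̂) ≤ 2 m(p)`. -/
theorem stmt15 {N T' : ℕ} (α : ℝ) (hα : α ∈ Set.Ioo (0 : ℝ) 1)
    (p ph : Fin N → ℝ)
    (hp : ∀ i, p i ∈ Set.Ioo (0 : ℝ) 1) (hph : ∀ i, ph i ∈ Set.Ioo (0 : ℝ) 1)
    (h1 : ∀ i, |ph i - p i| ≤
      p i * Real.sqrt (27 * Real.log (2 * (N : ℝ) * (T' : ℝ)) / (α * p i * (T' : ℝ))))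
    (h2 : ∀ i, |(1 - ph i) - (1 - p i)| ≤
      (1 - p i) *
        Real.sqrt (27 * Real.log (2 * (N : ℝ) * (T' : ℝ)) / (α * (1 - p i) * (T' : ℝ))))
    (hT : 108 * mVal p * Real.log (2 * (N : ℝ) * (T' : ℝ)) / α < (T' : ℝ)) :
    (2 / 3) * mVal p ≤ mVal ph ∧ mVal ph ≤ 2 * mVal p := by
  rcases Nat.eq_zero_or_pos N with rfl | hN
  · rw [Subsingleton.elim ph p]
    have : mVal p = 0 := by
      refine le_antisymm (le_of_forall_pos_le_add fun e he => ?_)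
        (le_csInf (mVal_set_nonempty p) fun s hs => hs.1.le)
      simpa using mVal_le he (by simpa [Finset.eq_empty_of_isEmpty] using he.le)
    simp [this]
  have hm : 0 < mVal p := zero_lt_one.trans_le (one_le_mVal hN p)
  obtain ⟨hα0, -⟩ := hα
  set L := Real.log (2 * (N : ℝ) * (T' : ℝ)) with hL
  have hT0 : (0 : ℝ) < T' := by
    rcases Nat.eq_zero_or_pos T' with rfl | h
    · simp [hL] at hT
    · exact_mod_cast h
  obtain ⟨c, hcdef⟩ : ∃ c, c = 27 * L / (α * T') := ⟨_, rfl⟩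
  have hc : c ≤ 1 / mVal p / 4 := by
    rw [div_lt_iff₀ hα0] at hT
    rw [hcdef, div_div, div_le_div_iff₀ (by positivity) (by positivity)]
    linarith
  have hq : ∀ x : ℝ, 27 * L / (α * x * T') = c / x := fun x => by
    rw [hcdef, div_div]
    congr 1
    ring
  simp only [hq] at h1 h2
  constructor
  · refine le_csInf (mVal_set_nonempty ph) ?_
    rintro s ⟨hs, hsc⟩
    by_contra! hlt
    have hr : 3 / 2 * (1 / (3 / 2 * s)) = 1 / s := by field_simp
    have hmr : 1 / mVal p ≤ 1 / (3 / 2 * s) :=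
      one_div_le_one_div_of_le (by positivity) (by linarith)
    have hsub : Ival p (3 / 2 * s) ⊆ Ival ph s := by
      intro n hn
      simp only [Ival, Finset.mem_filter, Finset.mem_univ, true_and, min_lt_iff] at hn ⊢
      rw [← hr]
      exact hn.imp
        (fun h => lt_of_abs_sub_le_mul_sqrt (hp n).1 hc (h1 n) h hmr)
        (fun h => lt_of_abs_sub_le_mul_sqrt (sub_pos.mpr (hp n).2) hc (h2 n) h hmr)
    have hle : ((Ival p (3 / 2 * s)).card : ℝ) ≤ (Ival ph s).card := by
      exact_mod_cast Finset.card_le_card hsub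
    have := mVal_le (v := p) (s := 3 / 2 * s) (by positivity) (by linarith)
    linarith
  · have hsub : Ival ph (2 * mVal p) ⊆ Ival p (mVal p) := by
      intro n
      simp only [Ival, Finset.mem_filter, Finset.mem_univ, true_and]
      contrapose!
      intro hn
      rw [le_min_iff] at hn ⊢
      exact ⟨half_le_of_abs_sub_le_mul_sqrt hm hc (h1 n) hn.1,
        half_le_of_abs_sub_le_mul_sqrt hm hc (h2 n) hn.2⟩
    have hle : ((Ival ph (2 * mVal p)).card : ℝ) ≤ (Ival p (mVal p)).card := by
      exact_mod_cast Finset.card_le_card hsub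
    have := card_Ival_mVal_le p hm
    exact mVal_le (by positivity) (by linarith)
end
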